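/- arXiv:0810.3019 — 5 statements merged into one kernel-verified Lean document; each statement's English description precedes it below -/
import Mathlib

section
/- For every integer d ≥ 1 there exists a constant K (depending only on d) such that for all integers c ≥ 2: every grid [a_1,…,a_d] in the obstruction set O(c,d) has volume ∏_{i=1}^d a_i ≤ K · c^{(3^d−1)/2}. -/
/-- A point of the grid `[a 0, …, a (d-1)]`: one coordinate in `Fin (a i)` for each `i`. -/
def GridPoint (d : ℕ) (a : Fin d → ℕ) : Type := (i : Fin d) → Fin (a i)

/-- A pair `p = (b, c)` with `b i < c i` for all `i` represents a (combinatorial) box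
`∏ i, {b i, c i}`; it is a monochromatic box for the coloring `f` if `f` is constant
on the `2^d` points of the box. -/
def IsMonoBox {d : ℕ} {a : Fin d → ℕ} {c : ℕ} (f : GridPoint d a → Fin c)
    (p : GridPoint d a × GridPoint d a) : Prop :=
  (∀ i, p.1 i < p.2 i) ∧
    ∃ s : Fin c, ∀ x : GridPoint d a, (∀ i, x i = p.1 i ∨ x i = p.2 i) → f x = s

/-- The set of monochromatic boxes of a coloring `f` (each box represented uniquely
by the pair of its coordinatewise-minimal and coordinatewise-maximal corners). -/
def monoBoxSet {d : ℕ} {a : Fin d → ℕ} {c : ℕ} (f : GridPoint d a → Fin c) :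
    Set (GridPoint d a × GridPoint d a) := {p | IsMonoBox f p}

/-- The grid `[a 0, …, a (d-1)]` is `(c,t)`-guaranteed: every `c`-coloring admits at
least `t` distinct monochromatic boxes.  `c`-guaranteed means `(c,1)`-guaranteed. -/
def Guaranteed (d : ℕ) (a : Fin d → ℕ) (c t : ℕ) : Prop :=
  ∀ f : GridPoint d a → Fin c, t ≤ (monoBoxSet f).ncard

/-- Membership in the obstruction set `O(c,d)`: the grid is `c`-guaranteed and is
minimal in the dominance order among `c`-guaranteed grids. -/
def InObstructionSet (d c : ℕ) (a : Fin d → ℕ) : Prop :=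
  Guaranteed d a c 1 ∧
    ∀ b : Fin d → ℕ, (∀ i, 1 ≤ b i) → (∀ i, b i ≤ a i) → b ≠ a → ¬ Guaranteed d b c 1

open Finset

instance GridPoint.instFintype (d : ℕ) (a : Fin d → ℕ) : Fintype (GridPoint d a) :=
  inferInstanceAs (Fintype ((i : Fin d) → Fin (a i)))

theorem GridPoint.card (d : ℕ) (a : Fin d → ℕ) : Fintype.card (GridPoint d a) = ∏ i, a i :=
  (Fintype.card_pi (α := fun i : Fin d => Fin (a i))).trans (by simp)

theorem guaranteed_one_iff {d : ℕ} {a : Fin d → ℕ} {c : ℕ} :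
    Guaranteed d a c 1 ↔ ∀ f : GridPoint d a → Fin c, ∃ p, IsMonoBox f p := by
  refine forall_congr' fun f => ?_
  exact Set.ncard_pos

/-- Guaranteed grids stay guaranteed after permuting coordinates and dropping some of them. -/
theorem Guaranteed.comp_injective {d s c : ℕ} {a : Fin d → ℕ} (h : Guaranteed d a c 1)
    {e : Fin s → Fin d} (he : Function.Injective e) : Guaranteed s (fun i => a (e i)) c 1 := by
  classical
  rw [guaranteed_one_iff] at h ⊢
  intro f
  obtain ⟨p, hp, t, ht⟩ := h fun x => f fun i => x (e i)
  refine ⟨(fun i => p.1 (e i), fun i => p.2 (e i)), fun i => hp (e i), t, fun x hx => ?_⟩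
  let y : GridPoint d a := fun j =>
    if ∃ i, e i = j ∧ (x i : ℕ) = p.2 j then p.2 j else p.1 j
  have hy : ∀ j, y j = p.1 j ∨ y j = p.2 j := fun j => by
    by_cases hj : ∃ i, e i = j ∧ (x i : ℕ) = p.2 j
    · exact Or.inr (if_pos hj)
    · exact Or.inl (if_neg hj)
  have hyx : (fun i => y (e i)) = x := by
    funext i
    by_cases hi : x i = p.2 (e i)
    · exact (if_pos ⟨i, rfl, congrArg Fin.val hi⟩).trans hi.symm
    · refine (if_neg ?_).trans ((hx i).resolve_right hi).symm
      rintro ⟨i', h', hi'⟩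
      obtain rfl := he h'
      exact hi (Fin.ext hi')
  exact (congrArg f hyx).symm.trans (ht y hy)

/-- Every `c`-coloring has at least a `1 / q` proportion of monochromatic boxes among all pairs
of grid points. -/
def DenselyGuaranteed (d : ℕ) (a : Fin d → ℕ) (c q : ℕ) : Prop :=
  ∀ f : GridPoint d a → Fin c, (∏ i, a i) ^ 2 ≤ q * (monoBoxSet f).ncard

theorem Guaranteed.densely {d c : ℕ} {a : Fin d → ℕ} (h : Guaranteed d a c 1) :
    DenselyGuaranteed d a c ((∏ i, a i) ^ 2) :=
  fun f => Nat.le_mul_of_pos_right _ (h f)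

theorem DenselyGuaranteed.guaranteed {d c q : ℕ} {a : Fin d → ℕ} (h : DenselyGuaranteed d a c q)
    (ha : ∀ i, 1 ≤ a i) : Guaranteed d a c 1 := by
  intro f
  have h1 : 0 < (∏ i, a i) ^ 2 := pow_pos (Finset.prod_pos fun i _ => ha i) 2
  exact Nat.pos_of_mul_pos_left (h1.trans_le (h f))

/-- `p` is a box on which `f` takes only the value `s`. -/
def IsBoxOfColor {d : ℕ} {a : Fin d → ℕ} {c : ℕ} (f : GridPoint d a → Fin c)
    (p : GridPoint d a × GridPoint d a) (s : Fin c) : Prop :=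
  (∀ i, p.1 i < p.2 i) ∧ ∀ x : GridPoint d a, (∀ i, x i = p.1 i ∨ x i = p.2 i) → f x = s

/-- The point of a `(d + 1)`-dimensional grid with first coordinates `x` and last coordinate `k`. -/
def GridPoint.extend {d : ℕ} {a : Fin (d + 1) → ℕ} (x : GridPoint d fun i => a i.castSucc)
    (k : Fin (a (Fin.last d))) : GridPoint (d + 1) a :=
  Fin.snoc (α := fun i => Fin (a i)) x k

@[simp] theorem GridPoint.extend_castSucc {d : ℕ} {a : Fin (d + 1) → ℕ}
    (x : GridPoint d fun i => a i.castSucc) (k : Fin (a (Fin.last d))) (i : Fin d) :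
    x.extend k i.castSucc = x i :=
  Fin.snoc_castSucc (α := fun i => Fin (a i)) k x i

@[simp] theorem GridPoint.extend_last {d : ℕ} {a : Fin (d + 1) → ℕ}
    (x : GridPoint d fun i => a i.castSucc) (k : Fin (a (Fin.last d))) :
    x.extend k (Fin.last d) = k :=
  Fin.snoc_last (α := fun i => Fin (a i)) k x

theorem GridPoint.extend_init {d : ℕ} {a : Fin (d + 1) → ℕ} (x : GridPoint (d + 1) a) :
    GridPoint.extend (fun i => x i.castSucc) (x (Fin.last d)) = x :=
  Fin.snoc_init_self (α := fun i => Fin (a i)) x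

theorem GridPoint.extend_inj {d : ℕ} {a : Fin (d + 1) → ℕ}
    {x y : GridPoint d fun i => a i.castSucc} {k l : Fin (a (Fin.last d))}
    (h : x.extend k = y.extend l) : x = y ∧ k = l :=
  ⟨funext fun i => by simpa using congrFun h i.castSucc, by simpa using congrFun h (Fin.last d)⟩

theorem IsBoxOfColor.extend {d c : ℕ} {a : Fin (d + 1) → ℕ} {f : GridPoint (d + 1) a → Fin c}
    {p : GridPoint d (fun i => a i.castSucc) × GridPoint d (fun i => a i.castSucc)} {s : Fin c}
    {k l : Fin (a (Fin.last d))} (hkl : k < l) (hk : IsBoxOfColor (fun x => f (x.extend k)) p s)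
    (hl : IsBoxOfColor (fun x => f (x.extend l)) p s) :
    IsMonoBox f (p.1.extend k, p.2.extend l) := by
  refine ⟨fun i => ?_, s, fun x hx => ?_⟩
  · induction i using Fin.lastCases with
    | last => simpa using hkl
    | cast i => simpa using hk.1 i
  · rw [← GridPoint.extend_init x]
    have hinit : ∀ i : Fin d, x i.castSucc = p.1 i ∨ x i.castSucc = p.2 i := fun i => by
      simpa using hx i.castSucc
    have hlast : x (Fin.last d) = k ∨ x (Fin.last d) = l := by simpa using hx (Fin.last d)
    rcases hlast with h | h <;> rw [h]
    · exact hk.2 _ hinit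
    · exact hl.2 _ hinit

theorem card_mul_self_le_two_mul_card_lt {α : Type*} [LinearOrder α] (L : Finset α) :
    #L * #L ≤ 2 * #{z ∈ L ×ˢ L | z.1 < z.2} + #L := by
  have hsub : L ×ˢ L ⊆ ({z ∈ L ×ˢ L | z.1 < z.2} ∪
      ({z ∈ L ×ˢ L | z.1 < z.2}).image Prod.swap) ∪ L.image fun k => (k, k) := by
    rintro ⟨x, y⟩ h
    rw [mem_product] at h
    rcases lt_trichotomy x y with hxy | hxy | hxy
    · simp [h.1, h.2, hxy]
    · subst hxy; simp_all
    · simp [h.1, h.2, hxy]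
  have h1 := card_le_card hsub
  rw [card_product] at h1
  have h2 := card_union_le ({z ∈ L ×ˢ L | z.1 < z.2} ∪
      ({z ∈ L ×ˢ L | z.1 < z.2}).image Prod.swap) (L.image fun k => (k, k))
  have h3 := card_union_le ({z ∈ L ×ˢ L | z.1 < z.2})
      (({z ∈ L ×ˢ L | z.1 < z.2}).image Prod.swap)
  have h4 : #(({z ∈ L ×ˢ L | z.1 < z.2}).image Prod.swap) ≤ _ := card_image_le
  have h5 : #(L.image fun k => (k, k)) ≤ _ := card_image_le
  omega

theorem density_increment {n W q c Z N S : ℕ} (hZ : n * W ≤ q * Z) (hS : Z ^ 2 ≤ W * c * S)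
    (hN : S ≤ 2 * N + Z) (hn : 4 * c * q ≤ n) : n ^ 2 * W ≤ 4 * c * q ^ 2 * N := by
  rcases Nat.eq_zero_or_pos W with rfl | hW
  · simp
  rcases Nat.eq_zero_or_pos q with rfl | hq
  · have : n = 0 := by
      rw [zero_mul, Nat.le_zero, mul_eq_zero] at hZ
      exact hZ.resolve_right hW.ne'
    simp [this]
  have h1 : 4 * c * W ≤ Z := by
    refine Nat.le_of_mul_le_mul_left ?_ hq
    calc q * (4 * c * W) = 4 * c * q * W := by ring
      _ ≤ n * W := Nat.mul_le_mul_right _ hn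
      _ ≤ q * Z := hZ
  have h2 : Z ^ 2 ≤ 4 * c * W * N := by
    have h3 : W * c * S ≤ W * c * (2 * N + Z) := Nat.mul_le_mul_left _ hN
    have h4 : 4 * c * W * Z ≤ Z * Z := Nat.mul_le_mul_right _ h1
    nlinarith
  refine Nat.le_of_mul_le_mul_left ?_ hW
  calc W * (n ^ 2 * W) = (n * W) ^ 2 := by ring
    _ ≤ (q * Z) ^ 2 := Nat.pow_le_pow_left hZ 2
    _ = q ^ 2 * Z ^ 2 := by ring
    _ ≤ q ^ 2 * (4 * c * W * N) := Nat.mul_le_mul_left _ h2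
    _ = W * (4 * c * q ^ 2 * N) := by ring

theorem DenselyGuaranteed.succ {d c q : ℕ} {a : Fin (d + 1) → ℕ}
    (h : DenselyGuaranteed d (fun i => a i.castSucc) c q) (hn : 4 * c * q ≤ a (Fin.last d)) :
    DenselyGuaranteed (d + 1) a c (4 * c * q ^ 2) := by
  classical
  intro f
  let P := GridPoint d fun i => a i.castSucc
  let L : (P × P) × Fin c → Finset (Fin (a (Fin.last d))) := fun b =>
    {k | IsBoxOfColor (fun x => f (x.extend k)) b.1 b.2}
  have hlayer : a (Fin.last d) * (∏ i : Fin d, a i.castSucc) ^ 2 ≤ q * ∑ b, #(L b) := by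
    have hcount : ∑ b, #(L b) = ∑ k : Fin (a (Fin.last d)),
        #{b : (P × P) × Fin c | IsBoxOfColor (fun x => f (x.extend k)) b.1 b.2} := by
      simp only [L, card_filter]
      exact sum_comm
    rw [hcount, mul_sum]
    have : ∀ k ∈ (univ : Finset (Fin (a (Fin.last d)))), (∏ i : Fin d, a i.castSucc) ^ 2 ≤
        q * #{b : (P × P) × Fin c | IsBoxOfColor (fun x => f (x.extend k)) b.1 b.2} := by
      intro k _
      refine (h fun x => f (x.extend k)).trans (Nat.mul_le_mul_left _ ?_)
      refine le_trans ?_ (card_image_le (f := Prod.fst))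
      rw [← Set.ncard_coe_finset]
      refine Set.ncard_le_ncard ?_
      rintro p ⟨hp, s, hs⟩
      simp only [coe_image, Set.mem_image, mem_coe, mem_filter, mem_univ, true_and]
      exact ⟨(p, s), ⟨hp, hs⟩, rfl⟩
    simpa using sum_le_sum this
  have hcs : (∑ b, #(L b)) ^ 2 ≤ (∏ i : Fin d, a i.castSucc) ^ 2 * c * ∑ b, #(L b) ^ 2 := by
    have h1 := sq_sum_le_card_mul_sum_sq (s := univ) (f := fun b => #(L b))
    have h2 : #(univ : Finset ((P × P) × Fin c)) = (∏ i : Fin d, a i.castSucc) ^ 2 * c := by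
      rw [card_univ, Fintype.card_prod, Fintype.card_prod, GridPoint.card, Fintype.card_fin, sq]
    rwa [h2] at h1
  have hpairs : ∑ b, #{z ∈ L b ×ˢ L b | z.1 < z.2} ≤ (monoBoxSet f).ncard := by
    rw [← card_sigma, ← Set.ncard_coe_finset]
    refine Set.ncard_le_ncard_of_injOn
      (fun w => (w.1.1.1.extend w.2.1, w.1.1.2.extend w.2.2)) ?_ ?_
    · rintro ⟨⟨p, s⟩, k, l⟩ hw
      simp only [L, coe_sigma, Set.mem_sigma_iff, mem_coe, mem_filter, mem_product, mem_univ,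
        true_and] at hw
      exact IsBoxOfColor.extend hw.2 hw.1.1 hw.1.2
    · rintro ⟨⟨p, s⟩, k, l⟩ hw ⟨⟨p', s'⟩, k', l'⟩ hw' heq
      simp only [L, coe_sigma, Set.mem_sigma_iff, mem_coe, mem_filter, mem_product, mem_univ,
        true_and] at hw hw'
      simp only [Prod.mk.injEq] at heq
      obtain ⟨h1, rfl⟩ := GridPoint.extend_inj heq.1
      obtain ⟨h2, rfl⟩ := GridPoint.extend_inj heq.2
      obtain rfl : p = p' := Prod.ext h1 h2
      have hs : s = s' := by
        rw [← hw.1.1.2 p.1 fun _ => Or.inl rfl, ← hw'.1.1.2 p.1 fun _ => Or.inl rfl]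
      rw [hs]
  have hS : ∑ b, #(L b) ^ 2 ≤ 2 * (monoBoxSet f).ncard + ∑ b, #(L b) := by
    refine le_trans ?_ (Nat.add_le_add_right (Nat.mul_le_mul_left 2 hpairs) _)
    rw [mul_sum, ← sum_add_distrib]
    refine sum_le_sum fun b _ => ?_
    rw [sq]
    exact card_mul_self_le_two_mul_card_lt (L b)
  have := density_increment hlayer hcs hS hn
  rwa [Fin.prod_univ_castSucc, mul_pow, mul_comm]

theorem DenselyGuaranteed.extend {s c q : ℕ} {G : ℕ → ℕ}
    (h : DenselyGuaranteed s (fun i => G i) c q)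
    (hG : ∀ j, G (s + j) = (4 * c * q) ^ 2 ^ j) (m : ℕ) :
    ∃ r, 4 * c * r = (4 * c * q) ^ 2 ^ m ∧ DenselyGuaranteed (s + m) (fun i => G i) c r := by
  induction m with
  | zero => exact ⟨q, by simp, h⟩
  | succ m ih =>
    obtain ⟨r, hr, hdense⟩ := ih
    refine ⟨4 * c * r ^ 2, ?_, DenselyGuaranteed.succ (a := fun i => G i) hdense ?_⟩
    · rw [pow_succ 2, pow_mul, ← hr]; ring
    · simp [hG, hr]

theorem exists_minimal_guaranteed {d c : ℕ} {a : Fin d → ℕ} (ha : ∀ i, 1 ≤ a i)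
    (h : Guaranteed d a c 1) :
    ∃ b : Fin d → ℕ, (∀ i, 1 ≤ b i) ∧ (∀ i, b i ≤ a i) ∧ InObstructionSet d c b := by
  obtain ⟨b, hba, hb⟩ := exists_minimal_le_of_wellFoundedLT
    (fun b : Fin d → ℕ => (∀ i, 1 ≤ b i) ∧ Guaranteed d b c 1) a ⟨ha, h⟩
  refine ⟨b, hb.prop.1, hba, hb.prop.2, fun b' h1 hle hne hg => hne ?_⟩
  exact le_antisymm hle (hb.le_of_le ⟨h1, hg⟩ hle)

theorem InObstructionSet.comp_perm {d c : ℕ} {a : Fin d → ℕ} (h : InObstructionSet d c a)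
    (σ : Equiv.Perm (Fin d)) : InObstructionSet d c (fun i => a (σ i)) := by
  refine ⟨h.1.comp_injective σ.injective, fun b h1 hle hne hg => ?_⟩
  refine h.2 (fun i => b (σ.symm i)) (fun i => h1 _) (fun i => ?_) (fun heq => hne ?_)
    (hg.comp_injective σ.symm.injective)
  · simpa using hle (σ.symm i)
  · funext i
    simpa using congrFun heq (σ i)

/-- In a minimal guaranteed grid, the coordinates from `s` on cannot all exceed the sizes
obtained by extending a minimal guaranteed subgrid of the first `s` coordinates. -/
theorem InObstructionSet.exists_le {d c s : ℕ} (hc : 1 ≤ c) (hs : s < d) {a : Fin d → ℕ}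
    (ha : ∀ i, 1 ≤ a i) (h : InObstructionSet d c a) :
    ∃ b : Fin s → ℕ, (∀ i, 1 ≤ b i) ∧ InObstructionSet s c b ∧
      ∃ i : Fin d, s ≤ i ∧ a i ≤ (4 * c * (∏ j, b j) ^ 2) ^ 2 ^ ((i : ℕ) - s) := by
  obtain ⟨b, hb1, hba, hb⟩ := exists_minimal_guaranteed (fun i => ha (Fin.castLE hs.le i))
    (h.1.comp_injective (Fin.castLE_injective hs.le))
  refine ⟨b, hb1, hb, ?_⟩
  by_contra! hlt
  set D := 4 * c * (∏ j, b j) ^ 2 with hD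
  have hDpos : 0 < D := by
    have : 0 < ∏ j, b j := Finset.prod_pos fun i _ => hb1 i
    positivity
  let G : ℕ → ℕ := fun i => if hi : i < s then b ⟨i, hi⟩ else D ^ 2 ^ (i - s)
  have hGb : (fun i : Fin s => G i) = b := by funext i; simp [G]
  have hdense : DenselyGuaranteed s (fun i => G i) c ((∏ j, b j) ^ 2) := by
    rw [hGb]; exact hb.1.densely
  obtain ⟨m, rfl⟩ := Nat.exists_eq_add_of_le hs.le
  obtain ⟨r, -, hr⟩ := hdense.extend (fun j => by simp [G, hD]) m
  have hG1 : ∀ i, 1 ≤ G i := by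
    intro i
    by_cases hi : i < s
    · simpa [G, hi] using hb1 ⟨i, hi⟩
    · simpa [G, hi, Nat.one_le_iff_ne_zero] using hDpos.ne'
  refine h.2 (fun i => G i) (fun i => hG1 i) (fun i => ?_) (fun heq => ?_)
    (hr.guaranteed fun i => hG1 i)
  · by_cases hi : (i : ℕ) < s
    · simpa [G, hi] using hba ⟨i, hi⟩
    · simpa [G, hi] using (hlt i (not_lt.mp hi)).le
  · have h1 := hlt ⟨s, hs⟩ le_rfl
    have h2 := congrFun heq ⟨s, hs⟩
    simp only [G, lt_irrefl, dite_false] at h2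
    exact h1.ne h2

theorem succ_mul_two_pow_le_geom_sum (m : ℕ) :
    (m + 1) * 2 ^ m ≤ ∑ j ∈ range (m + 1), 3 ^ j := by
  have hstep : ∀ m : ℕ, (m + 3) * 2 ^ m ≤ 3 ^ (m + 1) := by
    intro m
    induction m with
    | zero => norm_num
    | succ m ih =>
      have : 1 ≤ 2 ^ m := Nat.one_le_two_pow
      rw [pow_succ, pow_succ 3]
      nlinarith
  induction m with
  | zero => simp
  | succ m ih =>
    rw [sum_range_succ]
    have := hstep m
    rw [pow_succ 2]
    nlinarith

theorem prod_Ico_le_pow {d K c : ℕ} (hK : 1 ≤ K) (hc : 1 ≤ c) {A : ℕ → ℕ}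
    (hA : ∀ i j, i ≤ j → j < d → A i ≤ A j)
    (h : ∀ s < d, ∃ i, s ≤ i ∧ i < d ∧ A i ≤ (K * c ^ 3 ^ s) ^ 2 ^ (i - s))
    (s : ℕ) (hs : s ≤ d) : ∏ j ∈ Ico s d, A j ≤ (K * c) ^ ∑ j ∈ Ico s d, 3 ^ j := by
  induction hm : d - s using Nat.strong_induction_on generalizing s with
  | _ n ih =>
    rcases hs.eq_or_lt with rfl | hlt
    · simp
    obtain ⟨i, hsi, hid, hi⟩ := h s hlt
    have hrest := ih (d - (i + 1)) (by omega) (i + 1) hid rfl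
    rw [← prod_Ico_consecutive A (by omega : s ≤ i + 1) hid,
      ← sum_Ico_consecutive (fun j => 3 ^ j) (by omega : s ≤ i + 1) hid, pow_add]
    refine Nat.mul_le_mul ?_ hrest
    obtain ⟨m, rfl⟩ := Nat.exists_eq_add_of_le hsi
    have hsum : ∑ j ∈ Ico s (s + m + 1), 3 ^ j = 3 ^ s * ∑ j ∈ range (m + 1), 3 ^ j := by
      rw [sum_Ico_eq_sum_range, mul_sum, show s + m + 1 - s = m + 1 by omega]
      exact sum_congr rfl fun j _ => pow_add 3 s j
    have hbase : K * c ^ 3 ^ s ≤ (K * c) ^ 3 ^ s := by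
      rw [mul_pow]
      exact Nat.mul_le_mul_right _ (Nat.le_self_pow (by positivity) K)
    calc ∏ j ∈ Ico s (s + m + 1), A j ≤ ∏ _j ∈ Ico s (s + m + 1), A (s + m) :=
          prod_le_prod' fun j hj => hA _ _ (by rw [mem_Ico] at hj; omega) hid
      _ = A (s + m) ^ (m + 1) := by
          rw [prod_const, Nat.card_Ico, show s + m + 1 - s = m + 1 by omega]
      _ ≤ (((K * c) ^ 3 ^ s) ^ 2 ^ m) ^ (m + 1) := by
          refine Nat.pow_le_pow_left (hi.trans ?_) _
          rw [Nat.add_sub_cancel_left]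
          exact Nat.pow_le_pow_left hbase _
      _ = (K * c) ^ (3 ^ s * ((m + 1) * 2 ^ m)) := by
          rw [← pow_mul, ← pow_mul]; congr 1; ring
      _ ≤ (K * c) ^ ∑ j ∈ Ico s (s + m + 1), 3 ^ j := by
          rw [hsum]
          exact Nat.pow_le_pow_right (Nat.mul_pos hK hc)
            (Nat.mul_le_mul_left _ (succ_mul_two_pow_le_geom_sum m))

theorem two_mul_half_pred_three_pow (s : ℕ) : 2 * ((3 ^ s - 1) / 2) + 1 = 3 ^ s := by
  have : 3 ^ s % 2 = 1 := Nat.odd_iff.mp (Odd.pow (by decide))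
  generalize 3 ^ s = n at this ⊢
  omega

/-- every grid in `O(c,d)` has volume `O(c^((3^d - 1)/2))`. -/
theorem obstruction_volume_bound (d : ℕ) (hd : 1 ≤ d) :
    ∃ K : ℕ, ∀ c : ℕ, 2 ≤ c → ∀ a : Fin d → ℕ, (∀ i, 1 ≤ a i) →
      InObstructionSet d c a → (∏ i, a i) ≤ K * c ^ ((3 ^ d - 1) / 2) := by
  clear hd
  induction d using Nat.strong_induction_on with
  | _ d ih =>
  choose! k hk using ih
  set K := 1 + ∑ s ∈ range d, 4 * k s ^ 2 with hKdef
  refine ⟨K ^ ((3 ^ d - 1) / 2), fun c hc a ha h => ?_⟩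
  set σ := Tuple.sort a
  let A : ℕ → ℕ := fun j => if hj : j < d then a (σ ⟨j, hj⟩) else 0
  have hA : ∀ i j, i ≤ j → j < d → A i ≤ A j := by
    intro i j hij hj
    simp only [A, hj, hij.trans_lt hj, dite_true]
    exact Tuple.monotone_sort a (by simpa using hij)
  have hprod : ∏ i, a i = ∏ j ∈ Ico 0 d, A j := by
    rw [← Equiv.prod_comp σ a, ← range_eq_Ico, ← Fin.prod_univ_eq_prod_range]
    simp [A]
  have hexp : ∑ j ∈ Ico 0 d, 3 ^ j = (3 ^ d - 1) / 2 := by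
    rw [← range_eq_Ico, Nat.geomSum_eq (by norm_num)]
  rw [hprod, ← mul_pow, ← hexp]
  refine prod_Ico_le_pow (by omega) (by omega) hA (fun s hs => ?_) 0 (Nat.zero_le d)
  obtain ⟨b, hb1, hb, i, hsi, hi⟩ :=
    (h.comp_perm σ).exists_le (by omega : 1 ≤ c) hs fun i => ha (σ i)
  refine ⟨i, hsi, i.2, ?_⟩
  simp only [A, i.2, dite_true, Fin.eta]
  refine hi.trans (Nat.pow_le_pow_left ?_ _)
  have hkK : 4 * k s ^ 2 ≤ K := by
    have := single_le_sum (f := fun s => 4 * k s ^ 2) (fun _ _ => Nat.zero_le _)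
      (mem_range.mpr hs)
    omega
  calc 4 * c * (∏ j, b j) ^ 2 ≤ 4 * c * (k s * c ^ ((3 ^ s - 1) / 2)) ^ 2 :=
        Nat.mul_le_mul_left _ (Nat.pow_le_pow_left (hk s hs c hc b hb1 hb) 2)
    _ = 4 * k s ^ 2 * c ^ (2 * ((3 ^ s - 1) / 2) + 1) := by ring
    _ ≤ K * c ^ 3 ^ s := by
        rw [two_mul_half_pred_three_pow]
        exact Nat.mul_le_mul_right _ hkK
end

section
/- For an integer c ≥ 2, define the sequence μ_j(c) by μ_1(c) = 1 + c and μ_{j+1}(c) = 1 + c·∏_{i=1}^j binom(μ_i(c), 2). Then for every j ≥ 1, μ_j(c) ≥ 1 + 2^{(1−3^{j−1})/2} · c^{3^{j−1}}. -/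
/-- A sequence defined by a product of the previous `(μ i).choose 2` satisfies a one-step
cubic recurrence. -/
theorem sub_one_step (c : ℕ) (μ : ℕ → ℕ) (hμ1 : μ 1 = 1 + c)
    (hμrec : ∀ j : ℕ, 1 ≤ j → μ (j + 1) = 1 + c * ∏ i ∈ Finset.Icc 1 j, (μ i).choose 2)
    (j : ℕ) (hj : 1 ≤ j) :
    (μ (j + 1) : ℝ) - 1 = ((μ j : ℝ) - 1) * ((μ j : ℝ) * ((μ j : ℝ) - 1) / 2) := by
  rw [← Nat.cast_choose_two]
  have h : μ (j + 1) = 1 + c * ∏ i ∈ Finset.Icc 1 j, (μ i).choose 2 := hμrec j hj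
  obtain rfl | ⟨k, hk, rfl⟩ : j = 1 ∨ ∃ k, 1 ≤ k ∧ j = k + 1 := by
    rcases hj.eq_or_lt with h1 | h1
    · exact Or.inl h1.symm
    · exact Or.inr ⟨j - 1, by omega, by omega⟩
  · rw [h]
    simp [hμ1]
  · rw [Finset.prod_Icc_succ_top (by omega)] at h
    have hk' : (μ (k + 1) : ℝ) = 1 + c * ∏ i ∈ Finset.Icc 1 k, ((μ i).choose 2 : ℝ) := by
      exact_mod_cast hμrec k hk
    have h' : (μ (k + 1 + 1) : ℝ) =
        1 + c * ((∏ i ∈ Finset.Icc 1 k, ((μ i).choose 2 : ℝ)) * ((μ (k + 1)).choose 2 : ℝ)) := by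
      exact_mod_cast h
    linear_combination h' - ((μ (k + 1)).choose 2 : ℝ) * hk'

/-- `μ_j(c) ≥ 1 + 2^((1 - 3^(j-1))/2) c^(3^(j-1))` for all `j ≥ 1`. -/
theorem mu_lower_bound (c : ℕ) (hc : 2 ≤ c) (μ : ℕ → ℕ) (hμ1 : μ 1 = 1 + c)
    (hμrec : ∀ j : ℕ, 1 ≤ j → μ (j + 1) = 1 + c * ∏ i ∈ Finset.Icc 1 j, (μ i).choose 2) :
    ∀ j : ℕ, 1 ≤ j →
      1 + (2 : ℝ) ^ (((1 : ℝ) - 3 ^ (j - 1)) / 2) * (c : ℝ) ^ (3 ^ (j - 1)) ≤ (μ j : ℝ) := by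
  intro j hj
  induction j, hj using Nat.le_induction with
  | base => simp [hμ1]
  | succ j hj ih =>
    have hstep := sub_one_step c μ hμ1 hμrec j hj
    obtain ⟨k, rfl⟩ : ∃ k, j = k + 1 := ⟨j - 1, by omega⟩
    simp only [Nat.add_sub_cancel] at ih ⊢
    set b : ℝ := (2 : ℝ) ^ (((1 : ℝ) - 3 ^ k) / 2) * (c : ℝ) ^ (3 ^ k) with hb
    have hb0 : 0 ≤ b := by positivity
    have hnext : (2 : ℝ) ^ (((1 : ℝ) - 3 ^ (k + 1)) / 2) * (c : ℝ) ^ (3 ^ (k + 1)) =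
        b ^ 3 / 2 := by
      have he : ((1 : ℝ) - 3 ^ (k + 1)) / 2 = ((1 : ℝ) - 3 ^ k) / 2 * (3 : ℕ) - 1 := by
        push_cast
        ring
      rw [he, Real.rpow_sub_one two_ne_zero, Real.rpow_mul_natCast zero_le_two, hb, mul_pow,
        ← pow_mul, ← pow_succ]
      ring
    rw [hnext]
    have hx : b ≤ (μ (k + 1) : ℝ) - 1 := by linarith
    have hcube : b ^ 3 ≤ ((μ (k + 1) : ℝ) - 1) ^ 3 := pow_le_pow_left₀ hb0 hx 3
    nlinarith [sq_nonneg ((μ (k + 1) : ℝ) - 1)]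
end

section
/- For an integer c ≥ 2, define the sequence μ_j(c) by μ_1(c) = 1 + c and μ_{j+1}(c) = 1 + c·∏_{i=1}^j binom(μ_i(c), 2). Then for every integer d ≥ 1, the grid [μ_1(c),…,μ_d(c)] is c-guaranteed: every c-coloring of it admits a monochromatic box. -/
theorem card_ordered_pairs_le (n : ℕ) :
    Fintype.card {q : Fin n × Fin n // q.1 < q.2} ≤ n.choose 2 := by
  have h : Fintype.card {q : Fin n × Fin n // q.1 < q.2} ≤
      Fintype.card {s : Finset (Fin n) // s.card = 2} := by
    refine Fintype.card_le_of_injective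
      (fun q => ⟨{q.1.1, q.1.2}, Finset.card_pair q.2.ne⟩) ?_
    rintro ⟨⟨x, y⟩, hxy⟩ ⟨⟨z, w⟩, hzw⟩ h
    have h' : ({x, y} : Finset (Fin n)) = {z, w} := congrArg Subtype.val h
    have hx : x ∈ ({z, w} : Finset (Fin n)) := h' ▸ by simp
    have hy : y ∈ ({z, w} : Finset (Fin n)) := h' ▸ by simp
    simp only [Finset.mem_insert, Finset.mem_singleton] at hx hy
    simp only at hxy hzw
    simp only [Subtype.mk.injEq, Prod.mk.injEq]
    omega
  simpa using h

/-- If every side is longer than `c` times the number of boxes in the preceding sides, then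
every `c`-coloring of the grid has a monochromatic box. -/
theorem exists_isMonoBox {c : ℕ} (a : ℕ → ℕ)
    (ha : ∀ j, c * ∏ i ∈ Finset.range j, (a i).choose 2 < a j) (d : ℕ)
    (f : GridPoint d (fun i => a i) → Fin c) : ∃ p, IsMonoBox f p := by
  induction d with
  | zero =>
    refine ⟨(fun i => i.elim0, fun i => i.elim0), fun i => i.elim0,
      f (fun i => i.elim0), fun x _ => ?_⟩
    congr 1
    exact funext fun i => i.elim0
  | succ d ih =>
    let ext (x : GridPoint d (fun i => a i)) (k : Fin (a d)) :
        GridPoint (d + 1) (fun i => a i) :=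
      Fin.snoc (α := fun i : Fin (d + 1) => Fin (a i)) x k
    have ext_castSucc (x k) (i : Fin d) : ext x k i.castSucc = x i :=
      Fin.snoc_castSucc (α := fun i : Fin (d + 1) => Fin (a i)) k x i
    have ext_last (x k) : ext x k (Fin.last d) = k :=
      Fin.snoc_last (α := fun i : Fin (d + 1) => Fin (a i)) k x
    have key (k : Fin (a d)) :
        ∃ q : ((i : Fin d) → {q : Fin (a i) × Fin (a i) // q.1 < q.2}) × Fin c,
          ∀ x : GridPoint d (fun i => a i),
            (∀ i, x i = (q.1 i).1.1 ∨ x i = (q.1 i).1.2) → f (ext x k) = q.2 := by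
      obtain ⟨p, hp, s, hs⟩ := ih fun x => f (ext x k)
      exact ⟨(fun i => ⟨(p.1 i, p.2 i), hp i⟩, s), hs⟩
    choose F hF using key
    obtain ⟨k, l, hkl, hFkl⟩ : ∃ k l, k < l ∧ F k = F l := by
      obtain ⟨k, l, hne, h⟩ := Fintype.exists_ne_map_eq_of_card_lt F (by
        rw [Fintype.card_prod, Fintype.card_pi, Fintype.card_fin, Fintype.card_fin, mul_comm]
        refine lt_of_le_of_lt (Nat.mul_le_mul_left c ?_) (ha d)
        rw [Finset.prod_range]
        exact Finset.prod_le_prod' fun i _ => card_ordered_pairs_le _)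
      rcases hne.lt_or_gt with hlt | hlt
      exacts [⟨k, l, hlt, h⟩, ⟨l, k, hlt, h.symm⟩]
    let p : GridPoint d (fun i => a i) := fun i => ((F k).1 i).1.1
    let q : GridPoint d (fun i => a i) := fun i => ((F k).1 i).1.2
    have hpq (i : Fin d) : p i < q i := ((F k).1 i).2
    refine ⟨(ext p k, ext q l),
      fun i => ?_, (F k).2, fun x hx => ?_⟩
    · refine Fin.lastCases ?_ (fun i => ?_) i
      · exact lt_of_eq_of_lt (ext_last p k) (lt_of_lt_of_eq hkl (ext_last q l).symm)
      · exact lt_of_eq_of_lt (ext_castSucc p k i)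
            (lt_of_lt_of_eq (hpq i) (ext_castSucc q l i).symm)
    · have hinit (i : Fin d) :
          x i.castSucc = p i ∨ x i.castSucc = q i :=
        (hx i.castSucc).imp (fun h => h.trans (ext_castSucc p k i))
          (fun h => h.trans (ext_castSucc q l i))
      have hx_eq : ext (fun i => x i.castSucc) (x (Fin.last d)) = x :=
        Fin.snoc_init_self (α := fun i : Fin (d + 1) => Fin (a i)) x
      have hlast : x (Fin.last d) = k ∨ x (Fin.last d) = l :=
        (hx (Fin.last d)).imp (fun h => h.trans (ext_last p k))
          (fun h => h.trans (ext_last q l))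
      rw [← hx_eq]
      rcases hlast with h | h
      · rw [h]
        exact hF k _ hinit
      · rw [h, hFkl]
        exact hF l _ fun i => hFkl ▸ hinit i

/-- `[μ_1(c),…,μ_d(c)]` is `c`-guaranteed. -/
theorem mu_grid_guaranteed (c : ℕ) (hc : 2 ≤ c) (μ : ℕ → ℕ) (hμ1 : μ 1 = 1 + c)
    (hμrec : ∀ j : ℕ, 1 ≤ j → μ (j + 1) = 1 + c * ∏ i ∈ Finset.Icc 1 j, (μ i).choose 2)
    (d : ℕ) (hd : 1 ≤ d) :
    Guaranteed d (fun i : Fin d => μ ((i : ℕ) + 1)) c 1 := by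
  intro f
  have hprod (j : ℕ) : ∏ i ∈ Finset.range j, (μ (i + 1)).choose 2 =
      ∏ i ∈ Finset.Icc 1 j, (μ i).choose 2 := by
    induction j with
    | zero => simp
    | succ j ih => rw [Finset.prod_range_succ, Finset.prod_Icc_succ_top (by omega), ih]
  obtain ⟨p, hp⟩ := exists_isMonoBox (fun i => μ (i + 1)) (fun j => by
    rcases Nat.eq_zero_or_pos j with rfl | hj
    · simp [hμ1]
    · rw [hprod, hμrec j hj]
      omega) d f
  have : Finite (GridPoint d fun i : Fin d => μ ((i : ℕ) + 1)) :=
    inferInstanceAs (Finite ((i : Fin d) → Fin (μ ((i : ℕ) + 1))))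
  exact (Set.ncard_pos (Set.toFinite _)).2 ⟨p, hp⟩
end

section
/- For an integer c ≥ 2, define the sequence μ_j(c) by μ_1(c) = 1 + c and μ_{j+1}(c) = 1 + c·∏_{i=1}^j binom(μ_i(c), 2). Then for every integer d ≥ 1, there exists a c-coloring of the grid [μ_1(c),…,μ_d(c)] admitting exactly one monochromatic box; in particular, [μ_1(c),…,μ_d(c)] is not (c,2)-guaranteed. -/
/-- `f` takes the constant value `s` on the product of the sets `B i`. -/
def ConstOnBox {d : ℕ} {a : Fin d → ℕ} {c : ℕ} (f : ((i : Fin d) → Fin (a i)) → Fin c)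
    (B : (i : Fin d) → Finset (Fin (a i))) (s : Fin c) : Prop :=
  ∀ x : (i : Fin d) → Fin (a i), (∀ i, x i ∈ B i) → f x = s

/-- The product of the `B i` is the only monochromatic box of `f`, and its color is `s`. -/
def HasUniqueMonoBox {d : ℕ} {a : Fin d → ℕ} {c : ℕ} (f : ((i : Fin d) → Fin (a i)) → Fin c)
    (B : (i : Fin d) → Finset (Fin (a i))) (s : Fin c) : Prop :=
  ∀ B' : (i : Fin d) → Finset (Fin (a i)), (∀ i, (B' i).card = 2) →
    ∀ t, ConstOnBox f B' t ↔ B' = B ∧ t = s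

theorem exists_perm_mem_iff {α : Type*} [Fintype α] [DecidableEq α] {B C : Finset α}
    (h : B.card = C.card) : ∃ σ : Equiv.Perm α, ∀ x, σ x ∈ B ↔ x ∈ C := by
  let e : {x // x ∈ C} ≃ {x // x ∈ B} := Finset.equivOfCardEq h.symm
  refine ⟨e.extendSubtype, fun x => ⟨fun hx => ?_, fun hx => e.extendSubtype_mem x hx⟩⟩
  by_contra hn
  exact e.extendSubtype_not_mem x hn hx

/-- By permuting coordinates and colors, the unique monochromatic box and its color can be
prescribed arbitrarily. -/
theorem HasUniqueMonoBox.exists_of_card_eq_two {d : ℕ} {a : Fin d → ℕ} {c : ℕ}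
    {f : ((i : Fin d) → Fin (a i)) → Fin c} {B : (i : Fin d) → Finset (Fin (a i))} {s : Fin c}
    (hf : HasUniqueMonoBox f B s) (hB : ∀ i, (B i).card = 2)
    (C : (i : Fin d) → Finset (Fin (a i))) (hC : ∀ i, (C i).card = 2) (t : Fin c) :
    ∃ g : ((i : Fin d) → Fin (a i)) → Fin c, HasUniqueMonoBox g C t := by
  choose σ hσ using fun i => exists_perm_mem_iff ((hB i).trans (hC i).symm)
  refine ⟨fun x => Equiv.swap s t (f fun i => σ i (x i)), fun B' hB' u => ?_⟩
  have h := hf (fun i => (B' i).map (σ i).toEmbedding) (by simpa using hB') (Equiv.swap s t u)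
  have hmono : ConstOnBox (fun x => Equiv.swap s t (f fun i => σ i (x i))) B' u ↔
      ConstOnBox f (fun i => (B' i).map (σ i).toEmbedding) (Equiv.swap s t u) := by
    constructor
    · intro H x hx
      have := H (fun i => (σ i).symm (x i)) fun i => by
        have := hx i
        rwa [Finset.mem_map_equiv] at this
      simp only [Equiv.apply_symm_apply] at this
      rw [← this, Equiv.swap_apply_self]
    · intro H x hx
      simp only
      rw [H (fun i => σ i (x i)) fun i => Finset.mem_map_of_mem _ (hx i), Equiv.swap_apply_self]
  have hbox : (fun i => (B' i).map (σ i).toEmbedding) = B ↔ B' = C := by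
    rw [funext_iff, funext_iff]
    refine forall_congr' fun i => ?_
    have hCB : (C i).map (σ i).toEmbedding = B i := by
      ext x
      rw [Finset.mem_map_equiv, ← hσ, Equiv.apply_symm_apply]
    rw [← hCB, Finset.map_inj]
  have hcol : Equiv.swap s t u = s ↔ u = t := by
    rw [← Equiv.eq_symm_apply, Equiv.symm_swap, Equiv.swap_apply_left]
  rw [hmono, h, hbox, hcol]

/-- Stacking one layer for each pair of a box and a color, with one pair repeated, gives a
coloring with a unique monochromatic box in one more dimension. -/
theorem HasUniqueMonoBox.exists_succ {d c : ℕ} {a : Fin (d + 1) → ℕ}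
    (ha : a (Fin.last d) = 1 + c * ∏ i : Fin d, (a i.castSucc).choose 2)
    {f : ((i : Fin d) → Fin (a i.castSucc)) → Fin c}
    {B : (i : Fin d) → Finset (Fin (a i.castSucc))} {s : Fin c}
    (hf : HasUniqueMonoBox (a := fun i => a i.castSucc) f B s) (hB : ∀ i, (B i).card = 2) :
    ∃ (g : ((i : Fin (d + 1)) → Fin (a i)) → Fin c) (C : (i : Fin (d + 1)) → Finset (Fin (a i)))
      (t : Fin c), (∀ i, (C i).card = 2) ∧ HasUniqueMonoBox g C t := by
  classical
  let S : Finset ((i : Fin d) → Finset (Fin (a i.castSucc))) :=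
    Fintype.piFinset fun i => Finset.powersetCard 2 Finset.univ
  have hS : ∀ C, C ∈ S ↔ ∀ i, (C i).card = 2 := fun C => by
    simp [S, Fintype.mem_piFinset, Finset.mem_powersetCard]
  have hcard : Fintype.card (Option (S × Fin c)) = Fintype.card (Fin (a (Fin.last d))) := by
    rw [Fintype.card_option, Fintype.card_prod, Fintype.card_coe, Fintype.card_piFinset]
    simp [ha, add_comm, mul_comm]
  let e := Fintype.equivOfCardEq hcard
  let p₀ : S × Fin c := (⟨B, (hS B).2 hB⟩, s)
  let pair : Fin (a (Fin.last d)) → S × Fin c := fun w => (e.symm w).getD p₀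
  choose F hF using fun p : S × Fin c => HasUniqueMonoBox.exists_of_card_eq_two
    (a := fun i => a i.castSucc) hf hB p.1.1 ((hS _).1 p.1.2) p.2
  let L : Finset (Fin (a (Fin.last d))) := {e none, e (some p₀)}
  have hL : L.card = 2 := Finset.card_pair (by simp)
  have hpair : ∀ w ∈ L, pair w = p₀ := by
    intro w hw
    rcases Finset.mem_insert.1 hw with rfl | hw
    · simp [pair]
    · rw [Finset.mem_singleton.1 hw]; simp [pair]
  have hpair_const : ∀ (D : Finset (Fin (a (Fin.last d)))) (p : S × Fin c), D.card = 2 →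
      (∀ w ∈ D, pair w = p) → D = L ∧ p = p₀ := by
    intro D p hD hp
    obtain ⟨x, y, hxy, rfl⟩ := Finset.card_eq_two.1 hD
    have hx := hp x (by simp)
    have hy := hp y (by simp)
    obtain ⟨x, rfl⟩ := e.surjective x
    obtain ⟨y, rfl⟩ := e.surjective y
    simp only [pair, Equiv.symm_apply_apply] at hx hy
    rcases x with _ | x <;> rcases y with _ | y
    · exact absurd rfl hxy
    · simp only [Option.getD_none, Option.getD_some] at hx hy
      subst hx hy
      exact ⟨rfl, rfl⟩
    · simp only [Option.getD_none, Option.getD_some] at hx hy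
      subst hx hy
      exact ⟨Finset.pair_comm _ _, rfl⟩
    · simp only [Option.getD_some] at hx hy
      subst hx hy
      exact absurd rfl hxy
  refine ⟨fun x => F (pair (x (Fin.last d))) fun i => x i.castSucc,
    Fin.snoc (α := fun i => Finset (Fin (a i))) B L, s, ?_, ?_⟩
  · intro i
    refine Fin.lastCases ?_ (fun i => ?_) i
    · simpa using hL
    · simpa using hB i
  · intro B' hB' t
    have hlayer : ConstOnBox (fun x => F (pair (x (Fin.last d))) fun i => x i.castSucc) B' t ↔
        ∀ w ∈ B' (Fin.last d), ConstOnBox (a := fun i => a i.castSucc) (F (pair w))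
          (fun i => B' i.castSucc) t := by
      constructor
      · intro H w hw y hy
        have := H (Fin.snoc (α := fun i => Fin (a i)) y w) fun i => by
          refine Fin.lastCases ?_ (fun i => ?_) i
          · simpa using hw
          · simpa using hy i
        simpa using this
      · intro H x hx
        exact H _ (hx _) _ fun i => hx _
    let q : S × Fin c := (⟨fun i => B' i.castSucc, (hS _).2 fun i => hB' _⟩, t)
    have hq : ∀ w, ConstOnBox (a := fun i => a i.castSucc) (F (pair w))
        (fun i => B' i.castSucc) t ↔ pair w = q := by
      intro w
      rw [hF (pair w) _ fun i => hB' _, Prod.ext_iff, Subtype.ext_iff, eq_comm, @eq_comm _ t]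
    rw [hlayer]
    simp only [hq]
    constructor
    · intro H
      obtain ⟨h1, h2⟩ := hpair_const _ q (hB' _) H
      obtain ⟨h3, h4⟩ := Prod.ext_iff.1 h2
      refine ⟨?_, h4⟩
      funext i
      refine Fin.lastCases ?_ (fun i => ?_) i
      · simpa using h1
      · simpa using congrFun (Subtype.ext_iff.1 h3) i
    · rintro ⟨rfl, rfl⟩ w hw
      rw [hpair w (by simpa using hw)]
      refine Prod.ext (Subtype.ext ?_) rfl
      funext i
      simp [p₀, q]

theorem HasUniqueMonoBox.ncard_monoBoxSet {d : ℕ} {a : Fin d → ℕ} {c : ℕ}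
    {f : ((i : Fin d) → Fin (a i)) → Fin c} {B : (i : Fin d) → Finset (Fin (a i))} {s : Fin c}
    (hf : HasUniqueMonoBox f B s) (hB : ∀ i, (B i).card = 2) :
    (monoBoxSet (a := a) f).ncard = 1 := by
  have hlt : ∀ i, ∃ x y, x < y ∧ B i = {x, y} := by
    intro i
    obtain ⟨x, y, hxy, h⟩ := Finset.card_eq_two.1 (hB i)
    rcases lt_or_gt_of_ne hxy with h' | h'
    · exact ⟨x, y, h', h⟩
    · exact ⟨y, x, h', h.trans (Finset.pair_comm _ _)⟩
  choose u v huv hBuv using hlt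
  have hconst : ∀ (p : GridPoint d a × GridPoint d a) (t : Fin c),
      (∀ x : GridPoint d a, (∀ i, x i = p.1 i ∨ x i = p.2 i) → f x = t) ↔
        ConstOnBox f (fun i => {p.1 i, p.2 i}) t := by
    intro p t
    simp only [ConstOnBox, Finset.mem_insert, Finset.mem_singleton]
    rfl
  refine Set.ncard_eq_one.2 ⟨(u, v), Set.ext fun p => ?_⟩
  rw [Set.mem_singleton_iff]
  constructor
  · rintro ⟨hp, t, ht⟩
    rw [hconst, hf _ fun i => Finset.card_pair (hp i).ne] at ht
    have key : ∀ i, p.1 i = u i ∧ p.2 i = v i := by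
      intro i
      have h : ({p.1 i, p.2 i} : Finset _) = {u i, v i} := (congrFun ht.1 i).trans (hBuv i)
      have h1 := hp i
      have h2 := huv i
      rw [← Finset.coe_inj, Finset.coe_pair, Finset.coe_pair, Set.pair_eq_pair_iff] at h
      rcases h with h | ⟨h3, h4⟩
      · exact h
      · rw [h3, h4] at h1
        exact absurd h1 h2.asymm
    exact Prod.ext (funext fun i => (key i).1) (funext fun i => (key i).2)
  · rintro rfl
    refine ⟨huv, s, ?_⟩
    rw [hconst, hf _ fun i => Finset.card_pair (huv i).ne]
    exact ⟨funext fun i => (hBuv i).symm, rfl⟩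

theorem exists_hasUniqueMonoBox {c : ℕ} (hc : 0 < c) {a : ℕ → ℕ}
    (ha : ∀ j, a j = 1 + c * ∏ i : Fin j, (a i).choose 2) (d : ℕ) :
    ∃ (f : ((i : Fin d) → Fin (a i)) → Fin c) (B : (i : Fin d) → Finset (Fin (a i)))
      (s : Fin c), (∀ i, (B i).card = 2) ∧ HasUniqueMonoBox (a := fun i => a i) f B s := by
  induction d with
  | zero =>
    refine ⟨fun _ => ⟨0, hc⟩, fun i => i.elim0, ⟨0, hc⟩, fun i => i.elim0, fun B' _ t => ?_⟩
    exact ⟨fun h => ⟨Subsingleton.elim _ _, (h (fun i => i.elim0) fun i => i.elim0).symm⟩,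
      fun h _ _ => h.2.symm⟩
  | succ d ih =>
    obtain ⟨f, B, s, hB, hf⟩ := ih
    exact HasUniqueMonoBox.exists_succ (a := fun i : Fin (d + 1) => a i)
      (by simpa using ha d) hf hB

/-- there is a `c`-coloring of `[μ_1(c),…,μ_d(c)]` with exactly one
monochromatic box; in particular the grid is not `(c,2)`-guaranteed. -/
theorem mu_grid_minimal_coloring (c : ℕ) (hc : 2 ≤ c) (μ : ℕ → ℕ) (hμ1 : μ 1 = 1 + c)
    (hμrec : ∀ j : ℕ, 1 ≤ j → μ (j + 1) = 1 + c * ∏ i ∈ Finset.Icc 1 j, (μ i).choose 2)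
    (d : ℕ) (hd : 1 ≤ d) :
    (∃ f : GridPoint d (fun i : Fin d => μ ((i : ℕ) + 1)) → Fin c,
        (monoBoxSet f).ncard = 1) ∧
      ¬ Guaranteed d (fun i : Fin d => μ ((i : ℕ) + 1)) c 2 := by
  have ha : ∀ j, μ (j + 1) = 1 + c * ∏ i : Fin j, (μ ((i : ℕ) + 1)).choose 2 := by
    intro j
    rw [Fin.prod_univ_eq_prod_range fun i => (μ (i + 1)).choose 2]
    rcases Nat.eq_zero_or_pos j with rfl | hj
    · simpa using hμ1
    · rw [hμrec j hj, Finset.range_eq_Ico,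
        Finset.prod_Ico_add' (fun i => (μ i).choose 2) 0 j 1]
      rfl
  obtain ⟨f, B, s, hB, hf⟩ :=
    exists_hasUniqueMonoBox (a := fun j => μ (j + 1)) (by omega : 0 < c) ha d
  have hcard := hf.ncard_monoBoxSet hB
  refine ⟨⟨f, hcard⟩, fun h => ?_⟩
  have := h f
  omega
end

section
/- Let c ≥ 1, t ≥ 1, d ≥ 1 be integers and a_1,…,a_d ≥ 2 be integers, and set M = ∏_{j=1}^d binom(a_j,2). If the grid R = [a_1,…,a_d] is (c,t)-guaranteed, then the (d+1)-dimensional grid [a_1,…,a_d, ⌊cM/t⌋ + 1] is c-guaranteed. -/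
instance (d : ℕ) (a : Fin d → ℕ) : Fintype (GridPoint d a) :=
  inferInstanceAs (Fintype ((i : Fin d) → Fin (a i)))

theorem card_filter_fst_lt_snd (n : ℕ) :
    (Finset.univ.filter fun q : Fin n × Fin n => q.1 < q.2).card = n.choose 2 := by
  rw [← Finset.univ_product_univ, Finset.card_filter, Finset.sum_product_right]
  simp only [← Finset.card_filter, Finset.filter_gt_eq_Iio, Fin.card_Iio]
  rw [Fin.sum_univ_eq_sum_range (fun i => i), Finset.sum_range_id, Nat.choose_two_right]

/-- The boxes of a grid, each represented by its minimal and maximal corners. -/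
noncomputable def boxFinset (d : ℕ) (a : Fin d → ℕ) : Finset (GridPoint d a × GridPoint d a) :=
  open Classical in Finset.univ.filter fun p => ∀ i, p.1 i < p.2 i

theorem card_boxFinset_le (d : ℕ) (a : Fin d → ℕ) :
    (boxFinset d a).card ≤ ∏ j, (a j).choose 2 := by
  simp only [← card_filter_fst_lt_snd]
  rw [← Fintype.card_piFinset]
  refine Finset.card_le_card_of_injOn (fun p i => (p.1 i, p.2 i)) ?_ ?_
  · intro p hp
    simpa [boxFinset] using hp
  · intro p _ q _ hpq
    have hpq' := fun i => Prod.ext_iff.1 (congrFun hpq i)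
    exact Prod.ext (funext fun i => (hpq' i).1) (funext fun i => (hpq' i).2)

/-- The point of a `(d + 1)`-dimensional grid lying over `x` in the layer `k`. -/
def GridPoint.snoc {d : ℕ} {a : Fin (d + 1) → ℕ} (x : GridPoint d (Fin.init a))
    (k : Fin (a (Fin.last d))) : GridPoint (d + 1) a :=
  Fin.snoc (α := fun i => Fin (a i)) x k

@[simp]
theorem GridPoint.snoc_last {d : ℕ} {a : Fin (d + 1) → ℕ} (x : GridPoint d (Fin.init a))
    (k : Fin (a (Fin.last d))) : x.snoc k (Fin.last d) = k :=
  Fin.snoc_last (α := fun i => Fin (a i)) k x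

@[simp]
theorem GridPoint.snoc_castSucc {d : ℕ} {a : Fin (d + 1) → ℕ} (x : GridPoint d (Fin.init a))
    (k : Fin (a (Fin.last d))) (i : Fin d) : x.snoc k i.castSucc = x i :=
  Fin.snoc_castSucc (α := fun i => Fin (a i)) k x i

theorem isMonoBox_snoc {d c : ℕ} {a : Fin (d + 1) → ℕ} {f : GridPoint (d + 1) a → Fin c}
    {p : GridPoint d (Fin.init a) × GridPoint d (Fin.init a)} {k l : Fin (a (Fin.last d))}
    (hkl : k < l) (hk : IsMonoBox (fun x => f (x.snoc k)) p)
    (hl : IsMonoBox (fun x => f (x.snoc l)) p)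
    (hc : f (p.1.snoc k) = f (p.1.snoc l)) :
    IsMonoBox f (p.1.snoc k, p.2.snoc l) := by
  obtain ⟨hlt, s, hs⟩ := hk
  obtain ⟨-, u, hu⟩ := hl
  have hsu : s = u := by
    exact (hs p.1 fun i => Or.inl rfl).symm.trans (hc.trans (hu p.1 fun i => Or.inl rfl))
  subst hsu
  refine ⟨fun i => ?_, s, fun x hx => ?_⟩ <;> dsimp only at *
  · refine Fin.lastCases ?_ (fun j => ?_) i
    · simpa using hkl
    · rw [GridPoint.snoc_castSucc, GridPoint.snoc_castSucc]
      exact hlt j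
  · let y : GridPoint d (Fin.init a) := fun i => x i.castSucc
    have hxy : x = y.snoc (x (Fin.last d)) :=
      (Fin.snoc_init_self (α := fun i => Fin (a i)) x).symm
    have hy : ∀ i, y i = p.1 i ∨ y i = p.2 i := fun i => by
      have := hx i.castSucc
      rwa [GridPoint.snoc_castSucc, GridPoint.snoc_castSucc] at this
    have hlast : x (Fin.last d) = k ∨ x (Fin.last d) = l := by
      simpa using hx (Fin.last d)
    rw [hxy]
    rcases hlast with h | h <;> rw [h]
    · exact hs y hy
    · exact hu y hy

theorem Guaranteed.of_init {c t d : ℕ} {a : Fin (d + 1) → ℕ}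
    (h : Guaranteed d (Fin.init a) c t)
    (hlt : c * ∏ j, (Fin.init a j).choose 2 < a (Fin.last d) * t) :
    Guaranteed (d + 1) a c 1 := by
  classical
  intro f
  let S : Fin (a (Fin.last d)) → Finset (GridPoint d (Fin.init a) × GridPoint d (Fin.init a)) :=
    fun k => (monoBoxSet fun x => f (x.snoc k)).toFinset
  have hS : ∀ k, t ≤ (S k).card := fun k => by
    rw [← Set.ncard_eq_toFinset_card']
    exact h _
  have hmem : ∀ {k p}, p ∈ S k → IsMonoBox (fun x => f (x.snoc k)) p := fun {k p} hp =>
    (Set.mem_toFinset (s := monoBoxSet fun x => f (x.snoc k))).1 hp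
  have hcard : ((Finset.univ : Finset (Fin c)) ×ˢ boxFinset d (Fin.init a)).card <
      (Finset.univ.sigma S).card := by
    rw [Finset.card_product, Finset.card_sigma, Finset.card_univ, Fintype.card_fin]
    refine (Nat.mul_le_mul_left c (card_boxFinset_le d _)).trans_lt (hlt.trans_le ?_)
    simpa using Finset.card_nsmul_le_sum Finset.univ (fun k => (S k).card) t fun k _ => hS k
  obtain ⟨⟨k, p⟩, hk, ⟨l, q⟩, hl, hne, heq⟩ :=
    Finset.exists_ne_map_eq_of_card_lt_of_maps_to hcard
      (f := fun z => (f (z.2.1.snoc z.1), z.2)) (by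
        rintro ⟨k, p⟩ hp
        have hp' := hmem (Finset.mem_sigma.1 hp).2
        simpa [boxFinset] using hp'.1)
  obtain ⟨hc, rfl⟩ := Prod.ext_iff.1 heq
  replace hk := hmem (Finset.mem_sigma.1 hk).2
  replace hl := hmem (Finset.mem_sigma.1 hl).2
  have hkl : k ≠ l := fun e => hne (by rw [e])
  rw [Nat.one_le_iff_ne_zero, ← Nat.pos_iff_ne_zero, Set.ncard_pos]
  rcases hkl.lt_or_gt with hkl | hkl
  · exact ⟨_, isMonoBox_snoc hkl hk hl hc⟩
  · exact ⟨_, isMonoBox_snoc hkl hl hk hc.symm⟩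

/-- if `R = [a_1,…,a_d]` is `(c,t)`-guaranteed then
`R × [⌊cM/t⌋ + 1]` is `c`-guaranteed, where `M = ∏ (a_j choose 2)`. -/
theorem extend_guaranteed (c t d : ℕ) (hc : 1 ≤ c) (ht : 1 ≤ t) (hd : 1 ≤ d)
    (a : Fin d → ℕ) (ha : ∀ i, 2 ≤ a i)
    (h : Guaranteed d a c t) :
    Guaranteed (d + 1) (Fin.snoc a (c * (∏ j, (a j).choose 2) / t + 1)) c 1 := by
  apply Guaranteed.of_init (t := t)
  · rwa [Fin.init_snoc]
  · rw [Fin.init_snoc, Fin.snoc_last, mul_comm (_ + 1) t]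
    exact Nat.lt_mul_div_succ _ ht
end
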